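/- arXiv:math/0701346 — 2 statements merged into one kernel-verified Lean document; each statement's English description precedes it below -/
import Mathlib

section
/- Let G be a weighted graph on n vertices with all edge weights at most β_max, and fix k ≥ 1. Let N'_k(G(1/n)) denote the number of vertices of the random graph G(1/n) that lie in components with exactly k vertices that are not trees. Then E(N'_k(G(1/n))) ≤ k²·max{1, β_max^k}. -/
open MeasureTheory Filter Topology

noncomputable section

namespace Percolation

/-- The symmetrized lift of a two-variable real function to `Sym2`. If `f` is symmetric,
`sym2Val f s(a, b) = f a b`. -/
def sym2Val {α : Type*} (f : α → α → ℝ) : Sym2 α → ℝ :=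
  Sym2.lift ⟨fun a b => (f a b + f b a) / 2, fun a b => by simp [add_comm]⟩

/-- The product over the edges of `F` of a symmetric function of the endpoints. -/
def edgeProd {k : ℕ} (F : SimpleGraph (Fin k)) (f : Fin k → Fin k → ℝ) : ℝ := by
  classical exact ∏ e ∈ F.edgeFinset, sym2Val f e

/-- The homomorphism density `t(F, G)` of a finite simple graph `F` in the weighted graph
on `[n]` with edge weights `β`. -/
def homDensityG {n k : ℕ} (β : Fin n → Fin n → ℝ) (F : SimpleGraph (Fin k)) : ℝ :=
  (∑ v : Fin k → Fin n, edgeProd F fun i j => β (v i) (v j)) / (n : ℝ) ^ k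

/-- The unit interval `[0,1] ⊆ ℝ`. -/
def I01 : Set ℝ := Set.Icc 0 1

/-- The homomorphism density `t(F, W)` of a finite simple graph `F` in a graphon `W`. -/
def homDensityW {k : ℕ} (W : ℝ → ℝ → ℝ) (F : SimpleGraph (Fin k)) : ℝ :=
  ∫ x : Fin k → ℝ in Set.univ.pi fun _ => I01, edgeProd F fun i j => W (x i) (x j)

/-- `G_n → W`: convergence of the homomorphism densities for every finite simple graph. -/
def ConvergesTo (β : ∀ n : ℕ, Fin n → Fin n → ℝ) (W : ℝ → ℝ → ℝ) : Prop :=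
  ∀ (k : ℕ) (F : SimpleGraph (Fin k)),
    Tendsto (fun n => homDensityG (β n) F) atTop (nhds (homDensityW W F))

/-- `W` is a graphon: a bounded symmetric measurable function with nonnegative values. -/
def IsGraphon (W : ℝ → ℝ → ℝ) : Prop :=
  Measurable (Function.uncurry W) ∧ (∀ x y, 0 ≤ W x y) ∧ (∀ x y, W x y = W y x) ∧
    ∃ M : ℝ, ∀ x y, W x y ≤ M

/-- The Bernoulli measure on `Bool` with success probability `p`. -/
def bern (p : ℝ) : Measure Bool :=
  ENNReal.ofReal p • Measure.dirac true + ENNReal.ofReal (1 - p) • Measure.dirac false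

/-- The law of the random graph in which each pair `{v, w}` is an edge independently
with probability `min (p * β v w) 1`; a point of the sample space records for each
unordered pair whether it is an edge. -/
def percMeasure {V : Type*} [Fintype V] [DecidableEq V] (β : V → V → ℝ) (p : ℝ) :
    Measure (Sym2 V → Bool) :=
  Measure.pi fun e => bern (min (p * sym2Val β e) 1)

/-- The simple graph determined by a point of the sample space. -/
def graphOf {V : Type*} (ω : Sym2 V → Bool) : SimpleGraph V :=
  SimpleGraph.fromRel fun i j => ω s(i, j)

/-- The number of vertices of the component of `v` in `G`. -/
def compSize {V : Type*} (G : SimpleGraph V) (v : V) : ℕ := {w | G.Reachable v w}.ncard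

/-- The number of vertices of the largest component of `G`. -/
def C1 {V : Type*} [Fintype V] (G : SimpleGraph V) : ℕ :=
  Finset.univ.sup fun v => compSize G v

/-- The number of vertices of the second largest component of `G` (zero if `G` is
connected): the largest value of `min (|C_v|, |C_w|)` over vertices `v`, `w` lying in
distinct components. -/
def C2 {V : Type*} (G : SimpleGraph V) : ℕ :=
  sSup {m | ∃ v w : V, ¬G.Reachable v w ∧ m = min (compSize G v) (compSize G w)}

/-- The operator `T_W` with kernel `W` applied to `f`. -/
def applyT (W : ℝ → ℝ → ℝ) (f : ℝ → ℝ) (x : ℝ) : ℝ := ∫ y in I01, W x y * f y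

/-- The `L²[0,1]` norm of a function. -/
def l2norm (f : ℝ → ℝ) : ℝ := Real.sqrt (∫ x in I01, f x ^ 2)

/-- The `L²`-operator norm `‖T_W‖` of the integral operator with kernel `W`. -/
def opNorm (W : ℝ → ℝ → ℝ) : ℝ :=
  sSup {r | ∃ f : ℝ → ℝ, Measurable f ∧
    MeasureTheory.IntegrableOn (fun x => f x ^ 2) I01 ∧
    l2norm f ≤ 1 ∧ r = l2norm (applyT W f)}

/-- The survival probability `ρ(W)` of the multitype Poisson branching process with
kernel `W`: the supremum of `∫ f` over measurable `f : [0,1] → [0,1]` satisfying the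
functional equation `f(x) = 1 - exp(-∫ W(x,y) f(y) dy)` almost everywhere. -/
def survival (W : ℝ → ℝ → ℝ) : ℝ :=
  sSup {r | ∃ f : ℝ → ℝ, Measurable f ∧ (∀ x, f x ∈ Set.Icc (0 : ℝ) 1) ∧
    (∀ᵐ x ∂volume.restrict I01, f x = 1 - Real.exp (-∫ y in I01, W x y * f y)) ∧
    r = ∫ x in I01, f x}

/-- A graphon `W` is irreducible if there is no measurable `A ⊆ [0,1]` with
`0 < μ(A) < 1` such that `W = 0` a.e. on `A × ([0,1] \ A)`. -/
def Irreducible (W : ℝ → ℝ → ℝ) : Prop :=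
  ¬∃ A : Set ℝ, MeasurableSet A ∧ A ⊆ I01 ∧ 0 < volume A ∧ volume A < 1 ∧
    ∀ᵐ p : ℝ × ℝ, p.1 ∈ A → p.2 ∈ I01 \ A → W p.1 p.2 = 0

end Percolation
namespace Percolation

/-- `v` lies in a component of `G` containing a cycle (i.e. a non-tree component). -/
def InNonTreeComp {V : Type*} (G : SimpleGraph V) (v : V) : Prop :=
  ∃ u, G.Reachable v u ∧ ∃ c : G.Walk u u, c.IsCycle

/-- The number of vertices of `G` lying in non-tree components with exactly `k`
vertices. -/
def Nk' {V : Type*} (G : SimpleGraph V) (k : ℕ) : ℕ :=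
  {v | compSize G v = k ∧ InNonTreeComp G v}.ncard

end Percolation


namespace Percolation

theorem graphOf_adj {V : Type*} (ω : Sym2 V → Bool) (a b : V) :
    (graphOf ω).Adj a b ↔ a ≠ b ∧ ω s(a, b) = true := by
  unfold graphOf
  rw [SimpleGraph.fromRel_adj, Sym2.eq_swap (a := b) (b := a), or_self]

theorem reach_of {V : Type*} {H K : SimpleGraph V}
    (h : ∀ a b, H.Adj a b → K.Reachable a b) {a b : V} (hr : H.Reachable a b) :
    K.Reachable a b := by
  obtain ⟨p⟩ := hr
  induction p with
  | nil => exact SimpleGraph.Reachable.refl _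
  | cons hadj _ ih => exact (h _ _ hadj).trans ih

theorem upd_adj {V : Type*} [DecidableEq V] (ω : Sym2 V → Bool) (e : Sym2 V) (a b : V) :
    (graphOf (Function.update ω e false)).Adj a b ↔ (graphOf ω).Adj a b ∧ s(a, b) ≠ e := by
  rw [graphOf_adj, graphOf_adj]
  by_cases h : s(a, b) = e
  · subst h; simp
  · simp [Function.update_of_ne h, h]

theorem reach_upd {V : Type*} [DecidableEq V] (ω : Sym2 V → Bool) (x y : V)
    (hxy : (graphOf (Function.update ω s(x, y) false)).Reachable x y) (a b : V) :
    (graphOf (Function.update ω s(x, y) false)).Reachable a b ↔ (graphOf ω).Reachable a b := by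
  constructor
  · exact reach_of fun a b h => ((upd_adj _ _ _ _).1 h).1.reachable
  · refine reach_of fun a b h => ?_
    by_cases he : s(a, b) = s(x, y)
    · rw [Sym2.eq_iff] at he
      rcases he with ⟨rfl, rfl⟩ | ⟨rfl, rfl⟩
      · exact hxy
      · exact hxy.symm
    · exact ((upd_adj _ _ _ _).2 ⟨h, he⟩).reachable

/-- The event `B_{v,x,y}`. -/
def evB {V : Type*} [DecidableEq V] (k : ℕ) (v x y : V) : Set (Sym2 V → Bool) :=
  {ω | compSize (graphOf (Function.update ω s(x, y) false)) v = k ∧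
    (graphOf (Function.update ω s(x, y) false)).Reachable v x ∧
    (graphOf (Function.update ω s(x, y) false)).Reachable v y}

theorem evB_spec {V : Type*} [DecidableEq V] (k : ℕ) (v x y : V) (ω : Sym2 V → Bool)
    (h : ω ∈ evB k v x y) :
    compSize (graphOf ω) v = k ∧ (graphOf ω).Reachable v x ∧ (graphOf ω).Reachable v y := by
  obtain ⟨h1, h2, h3⟩ := h
  have := reach_upd ω x y (h2.symm.trans h3)
  unfold compSize at *
  simp only [this] at h1 h2 h3
  exact ⟨h1, h2, h3⟩

theorem exists_evB {V : Type*} [DecidableEq V] (k : ℕ) (v : V) (ω : Sym2 V → Bool)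
    (h1 : compSize (graphOf ω) v = k) (h2 : InNonTreeComp (graphOf ω) v) :
    ∃ x y, ω s(x, y) = true ∧ ω ∈ evB k v x y := by
  obtain ⟨u, hu, c, hc⟩ := h2
  have hne : c.edges ≠ [] := by
    intro h0
    have h3 := hc.three_le_length
    rw [← SimpleGraph.Walk.length_edges, h0] at h3
    simp at h3
  obtain ⟨e, he⟩ := List.exists_mem_of_ne_nil _ hne
  induction e using Sym2.ind with
  | _ x y =>
    have hadj := SimpleGraph.adj_and_reachable_delete_edges_iff_exists_cycle.2 ⟨u, c, hc, he⟩
    have hx : (graphOf ω).Reachable v x :=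
      hu.trans (c.takeUntil x (c.fst_mem_support_of_mem_edges he)).reachable
    have hy := hx.trans hadj.1.reachable
    have hxy : (graphOf (Function.update ω s(x, y) false)).Reachable x y := by
      refine reach_of (fun a b h => ?_) hadj.2
      rw [SimpleGraph.deleteEdges_adj] at h
      exact ((upd_adj _ _ _ _).2 ⟨h.1, by simpa using h.2⟩).reachable
    refine ⟨x, y, ((graphOf_adj _ _ _).1 hadj.1).2, ?_⟩
    have := reach_upd ω x y hxy
    unfold evB compSize at *
    simp only [Set.mem_setOf_eq, this]
    exact ⟨h1, hx, hy⟩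

theorem bern_prob (p : ℝ) (h0 : 0 ≤ p) (h1 : p ≤ 1) : IsProbabilityMeasure (bern p) := by
  constructor
  simp only [bern, Measure.add_apply, Measure.smul_apply, measure_univ, smul_eq_mul, mul_one]
  rw [← ENNReal.ofReal_add h0 (by linarith)]
  simp

theorem pi_indep {ι : Type*} [Fintype ι] [DecidableEq ι] (p : ι → ℝ) (h0 : ∀ i, 0 ≤ p i)
    (h1 : ∀ i, p i ≤ 1) (e : ι) (B : Set (ι → Bool))
    (hB : ∀ ω, ω ∈ B ↔ Function.update ω e false ∈ B) :
    (Measure.pi fun i => bern (p i)).real ({ω | ω e = true} ∩ B) =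
      p e * (Measure.pi fun i => bern (p i)).real B := by
  haveI : ∀ i, IsProbabilityMeasure (bern (p i)) := fun i => bern_prob _ (h0 i) (h1 i)
  have hi := ProbabilityTheory.iIndepFun_pi (μ := fun i => bern (p i))
    (X := fun _ (b : Bool) => b) (fun i => aemeasurable_id)
  have hf := hi.indepFun_finset {e} {e}ᶜ disjoint_compl_right (fun i => measurable_pi_apply i)
  let S : Set (({e} : Finset ι) → Bool) := {η | η ⟨e, by simp⟩ = true}
  let T : Set ((({e} : Finset ι)ᶜ : Finset ι) → Bool) :=
    {η | (fun i => if h : i ∈ ({e} : Finset ι)ᶜ then η ⟨i, h⟩ else false) ∈ B}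
  have hm := hf.measure_inter_preimage_eq_mul S T (Set.toFinite _).measurableSet
    (Set.toFinite _).measurableSet
  have hT : (fun (a : ι → Bool) (i : (({e} : Finset ι)ᶜ : Finset ι)) => a i) ⁻¹' T = B := by
    ext ω
    rw [hB ω]
    simp only [T, Set.mem_preimage, Set.mem_setOf_eq]
    convert Iff.rfl using 2
    ext i
    by_cases h : i = e
    · subst h; simp
    · simp [h]
  have hS : (fun (a : ι → Bool) (i : ({e} : Finset ι)) => a i) ⁻¹' S = {ω | ω e = true} := rfl
  rw [hT, hS] at hm
  have hA : (Measure.pi fun i => bern (p i)) {ω | ω e = true} = ENNReal.ofReal (p e) := by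
    have := (measurePreserving_eval (fun i => bern (p i)) e).measure_preimage
      (s := {true}) (Set.toFinite _).measurableSet.nullMeasurableSet
    have h2 : (Function.eval e ⁻¹' {true} : Set (ι → Bool)) = {ω | ω e = true} := by
      ext; simp
    rw [← h2, this]
    simp [bern]
  rw [Measure.real, hm, hA, ENNReal.toReal_mul, ENNReal.toReal_ofReal (h0 e), Measure.real]

theorem sum_evB_le {n : ℕ} (k : ℕ) (v : Fin n) (ω : Sym2 (Fin n) → Bool) :
    ∑ x, ∑ y, (evB k v x y).indicator (fun _ => (1 : ℝ)) ω ≤ (k : ℝ) ^ 2 := by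
  classical
  by_cases hk : compSize (graphOf ω) v = k
  · have h : ∀ x y, (evB k v x y).indicator (fun _ => (1 : ℝ)) ω ≤
        (if (graphOf ω).Reachable v x then 1 else 0) *
          (if (graphOf ω).Reachable v y then 1 else 0) := by
      intro x y
      by_cases hm : ω ∈ evB k v x y
      · have := evB_spec k v x y ω hm
        simp [hm, this]
      · rw [Set.indicator_of_notMem hm]
        positivity
    calc _ ≤ ∑ x : Fin n, ∑ y : Fin n, (if (graphOf ω).Reachable v x then (1:ℝ) else 0) *
          (if (graphOf ω).Reachable v y then 1 else 0) :=
          Finset.sum_le_sum fun x _ => Finset.sum_le_sum fun y _ => h x y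
      _ = (k : ℝ) ^ 2 := by
          rw [← Finset.sum_mul_sum, ← sq]
          congr 1
          rw [Finset.sum_boole, ← hk, compSize, Set.ncard_eq_toFinset_card']
          simp
  · have h : ∀ x y, (evB k v x y).indicator (fun _ => (1 : ℝ)) ω = 0 := by
      intro x y
      exact Set.indicator_of_notMem (fun hm => hk (evB_spec k v x y ω hm).1) _
    simp only [h, Finset.sum_const_zero]
    positivity

theorem Nk_le {n : ℕ} (k : ℕ) (ω : Sym2 (Fin n) → Bool) :
    (Nk' (graphOf ω) k : ℝ) ≤ ∑ v, ∑ x, ∑ y,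
      ({ω : Sym2 (Fin n) → Bool | ω s(x, y) = true} ∩ evB k v x y).indicator
        (fun _ => (1 : ℝ)) ω := by
  classical
  have h : (Nk' (graphOf ω) k : ℝ) =
      ∑ v, if (compSize (graphOf ω) v = k ∧ InNonTreeComp (graphOf ω) v) then (1 : ℝ) else 0 := by
    rw [Finset.sum_boole, Nk', Set.ncard_eq_toFinset_card']
    simp
  rw [h]
  refine Finset.sum_le_sum fun v _ => ?_
  have hnn : ∀ x y, 0 ≤ ({ω : Sym2 (Fin n) → Bool | ω s(x, y) = true} ∩ evB k v x y).indicator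
        (fun _ => (1 : ℝ)) ω := fun x y => Set.indicator_nonneg (fun _ _ => zero_le_one) _
  split_ifs with hv
  · obtain ⟨x, y, h1, h2⟩ := exists_evB k v ω hv.1 hv.2
    have h3 : ({ω : Sym2 (Fin n) → Bool | ω s(x, y) = true} ∩ evB k v x y).indicator
        (fun _ => (1 : ℝ)) ω = 1 := by
      have hmem : ω ∈ {ω : Sym2 (Fin n) → Bool | ω s(x, y) = true} ∩ evB k v x y := ⟨h1, h2⟩
      exact Set.indicator_of_mem hmem _
    exact h3.symm.le.trans <| (Finset.single_le_sum (fun y _ => hnn x y) (Finset.mem_univ y)).trans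
      (Finset.single_le_sum (f := fun x => ∑ y, _)
        (fun x _ => Finset.sum_nonneg fun y _ => hnn x y) (Finset.mem_univ x))
  · exact Finset.sum_nonneg fun x _ => Finset.sum_nonneg fun y _ => hnn x y

end Percolation

open Percolation MeasureTheory Filter Topology in
/-- Let `G` be a weighted graph on `n` vertices with all edge weights
at most `βmax` and let `k ≥ 1`. Then the expected number of vertices of `G(1/n)` in
non-tree components with exactly `k` vertices is at most `k² max {1, βmax^k}`. -/
theorem expected_nontree_vertices_bound
    (n : ℕ) (β : Fin n → Fin n → ℝ) (βmax : ℝ)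
    (hsym : ∀ i j, β i j = β j i)
    (hnonneg : ∀ i j, 0 ≤ β i j)
    (hdiag : ∀ i, β i i = 0)
    (hbound : ∀ i j, β i j ≤ βmax)
    (k : ℕ) (hk : 1 ≤ k) :
    (∫ ω, (Nk' (graphOf ω) k : ℝ) ∂percMeasure β (1 / n)) ≤
      k ^ 2 * max 1 (βmax ^ k) := by
  have hrhs : (0 : ℝ) ≤ k ^ 2 * max 1 (βmax ^ k) := by positivity
  rcases Nat.eq_zero_or_pos n with hn | hn
  · subst hn
    have h0 : ∀ ω : Sym2 (Fin 0) → Bool, (Nk' (graphOf ω) k : ℝ) = 0 := by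
      intro ω
      have := Nk_le k ω
      simp only [Finset.univ_eq_empty, Finset.sum_empty] at this
      exact le_antisymm this (Nat.cast_nonneg _)
    simp only [h0, integral_zero]
    exact hrhs
  have hnR : (0 : ℝ) < n := Nat.cast_pos.2 hn
  have hb0 : 0 ≤ βmax := (hnonneg ⟨0, hn⟩ ⟨0, hn⟩).trans (hbound _ _)
  have hs0 : ∀ e, 0 ≤ sym2Val β e := by
    intro e
    induction e using Sym2.ind with
    | _ x y => simp only [sym2Val, Sym2.lift_mk]; linarith [hnonneg x y, hnonneg y x]
  have hs1 : ∀ e, sym2Val β e ≤ βmax := by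
    intro e
    induction e using Sym2.ind with
    | _ x y => simp only [sym2Val, Sym2.lift_mk]; linarith [hbound x y, hbound y x]
  have hp0 : ∀ e, 0 ≤ min (1 / (n : ℝ) * sym2Val β e) 1 := fun e =>
    le_min (mul_nonneg (by positivity) (hs0 e)) zero_le_one
  have hp1 : ∀ e, min (1 / (n : ℝ) * sym2Val β e) 1 ≤ 1 := fun e => min_le_right _ _
  haveI : ∀ e, IsProbabilityMeasure (bern (min (1 / (n : ℝ) * sym2Val β e) 1)) :=
    fun e => bern_prob _ (hp0 e) (hp1 e)
  haveI : IsProbabilityMeasure (percMeasure β (1 / n)) := by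
    unfold percMeasure; infer_instance
  set μ := percMeasure β (1 / n) with hμ
  have hint : ∀ f : (Sym2 (Fin n) → Bool) → ℝ, Integrable f μ := fun f => Integrable.of_finite
  have hms : ∀ s : Set (Sym2 (Fin n) → Bool), MeasurableSet s :=
    fun s => (Set.toFinite s).measurableSet
  have hind : ∀ s : Set (Sym2 (Fin n) → Bool),
      ∫ ω, s.indicator (fun _ => (1 : ℝ)) ω ∂μ = μ.real s := fun s => integral_indicator_one (hms s)
  have hone : ∀ v x y, μ.real ({ω : Sym2 (Fin n) → Bool | ω s(x, y) = true} ∩ evB k v x y) ≤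
      βmax / n * μ.real (evB k v x y) := by
    intro v x y
    have := pi_indep (fun e => min (1 / (n : ℝ) * sym2Val β e) 1) hp0 hp1 s(x, y) (evB k v x y)
      (fun ω => by simp [evB])
    rw [hμ, percMeasure, this]
    refine mul_le_mul_of_nonneg_right ((min_le_left _ _).trans ?_) measureReal_nonneg
    rw [one_div_mul_eq_div]
    exact div_le_div_of_nonneg_right (hs1 _) hnR.le
  have hsum : ∀ v, ∑ x, ∑ y, μ.real (evB k v x y) ≤ (k : ℝ) ^ 2 := by
    intro v
    have h1 : ∫ ω, ∑ x, ∑ y, (evB k v x y).indicator (fun _ => (1 : ℝ)) ω ∂μ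
        ≤ ∫ ω, (k : ℝ) ^ 2 ∂μ := integral_mono (hint _) (hint _) (fun ω => sum_evB_le k v ω)
    rw [integral_finsetSum _ (fun _ _ => hint _)] at h1
    simp_rw [integral_finsetSum _ (fun _ _ => hint _), hind] at h1
    simpa using h1
  have hmax : βmax ≤ max 1 (βmax ^ k) := by
    rcases le_total βmax 1 with h | h
    · exact h.trans (le_max_left _ _)
    · exact (le_self_pow₀ h (by omega)).trans (le_max_right _ _)
  calc ∫ ω, (Nk' (graphOf ω) k : ℝ) ∂μ
      ≤ ∫ ω, ∑ v, ∑ x, ∑ y,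
      ({ω : Sym2 (Fin n) → Bool | ω s(x, y) = true} ∩ evB k v x y).indicator
        (fun _ => (1 : ℝ)) ω ∂μ := integral_mono (hint _) (hint _) (fun ω => Nk_le k ω)
    _ = ∑ v, ∑ x, ∑ y, μ.real ({ω : Sym2 (Fin n) → Bool | ω s(x, y) = true} ∩ evB k v x y) := by
      rw [integral_finsetSum _ (fun _ _ => hint _)]
      simp_rw [integral_finsetSum _ (fun _ _ => hint _), hind]
    _ ≤ ∑ v, ∑ x, ∑ y, βmax / n * μ.real (evB k v x y) :=
      Finset.sum_le_sum fun v _ => Finset.sum_le_sum fun x _ => Finset.sum_le_sum fun y _ =>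
        hone v x y
    _ = ∑ v, βmax / n * ∑ x, ∑ y, μ.real (evB k v x y) := by
      simp_rw [Finset.mul_sum]
    _ ≤ ∑ _v : Fin n, βmax / n * (k : ℝ) ^ 2 :=
      Finset.sum_le_sum fun v _ => mul_le_mul_of_nonneg_left (hsum v) (by positivity)
    _ = k ^ 2 * βmax := by
      simp only [Finset.sum_const, Finset.card_univ, Fintype.card_fin, nsmul_eq_mul]
      field_simp
    _ ≤ k ^ 2 * max 1 (βmax ^ k) := mul_le_mul_of_nonneg_left hmax (by positivity)
end
end

section
/- Let (W_n) be a sequence of graphons with sup_n ‖W_n‖_∞ < ∞, and let W be a graphon. If δ_□(W_n, W) → 0 as n → ∞, then ‖T_{W_n}‖ → ‖T_W‖, where ‖T_U‖ denotes the L²-operator norm of the integral operator with kernel U. -/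
open MeasureTheory Filter Topology

noncomputable section

namespace Percolation

open MeasureTheory

/-- The cut norm `‖U‖_□` of a kernel on `[0,1]²`. -/
def cutNorm (U : ℝ → ℝ → ℝ) : ℝ :=
  sSup {r | ∃ A B : Set ℝ, MeasurableSet A ∧ MeasurableSet B ∧ A ⊆ I01 ∧ B ⊆ I01 ∧
    r = |∫ x in A, ∫ y in B, U x y|}

/-- The cut metric `δ_□(U, V)`: the infimum over measure-preserving bijections `φ` of
`[0,1]` of the cut norm of `U - V^φ`. -/
def cutDist (U V : ℝ → ℝ → ℝ) : ℝ :=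
  sInf {r | ∃ φ : ℝ → ℝ,
    MeasurePreserving φ (volume.restrict I01) (volume.restrict I01) ∧
    Set.BijOn φ I01 I01 ∧
    r = cutNorm fun x y => U x y - V (φ x) (φ y)}

end Percolation

namespace Percolation

open MeasureTheory

/-- Lebesgue measure on the unit interval. -/
abbrev mu01 : Measure ℝ := volume.restrict I01

theorem meas_I01 : MeasurableSet I01 := measurableSet_Icc

instance : IsProbabilityMeasure mu01 := ⟨by simp [mu01, I01]⟩

theorem int_of_bound {h : ℝ → ℝ} (hm : Measurable h) {K : ℝ} (hb : ∀ x, |h x| ≤ K)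
    (ν : Measure ℝ) [IsFiniteMeasure ν] : Integrable h ν :=
  Integrable.of_bound hm.aestronglyMeasurable K (ae_of_all _ hb)

theorem setInt_meas {D : ℝ → ℝ → ℝ} (hD : Measurable (Function.uncurry D))
    (ν : Measure ℝ) [SFinite ν] : Measurable fun x => ∫ y, D x y ∂ν :=
  (StronglyMeasurable.integral_prod_right (ν := ν) hD.stronglyMeasurable).measurable

theorem applyT_meas {D : ℝ → ℝ → ℝ} (hD : Measurable (Function.uncurry D))
    {f : ℝ → ℝ} (hf : Measurable f) : Measurable (applyT D f) := by
  have : Measurable (Function.uncurry fun x y => D x y * f y) :=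
    hD.mul (hf.comp measurable_snd)
  exact setInt_meas this mu01

theorem row_meas {D : ℝ → ℝ → ℝ} (hD : Measurable (Function.uncurry D)) (x : ℝ) :
    Measurable (D x) := hD.comp measurable_prodMk_left

theorem row_int {D : ℝ → ℝ → ℝ} (hD : Measurable (Function.uncurry D)) {K : ℝ}
    (hK : ∀ x y, |D x y| ≤ K) {f : ℝ → ℝ} (hf : Integrable f mu01) (x : ℝ) :
    Integrable (fun y => D x y * f y) mu01 :=
  hf.bdd_mul (row_meas hD x).aestronglyMeasurable (ae_of_all _ (hK x))

theorem applyT_bound {D : ℝ → ℝ → ℝ} {K : ℝ}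
    (hK : ∀ x y, |D x y| ≤ K) {f : ℝ → ℝ} (hf : Integrable f mu01) (x : ℝ) :
    |applyT D f x| ≤ K * ∫ y in I01, |f y| := by
  unfold applyT
  rw [← integral_const_mul, ← Real.norm_eq_abs]
  refine norm_integral_le_of_norm_le (hf.abs.const_mul K) (ae_of_all _ fun y => ?_)
  rw [Real.norm_eq_abs, abs_mul]
  exact mul_le_mul_of_nonneg_right (hK x y) (abs_nonneg _)

theorem sq_le_of_l2 {f : ℝ → ℝ} (h : l2norm f ≤ 1) : ∫ x in I01, f x ^ 2 ≤ 1 := by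
  unfold l2norm at h
  rw [Real.sqrt_le_left zero_le_one] at h
  simpa using h

theorem l1_le {f : ℝ → ℝ} (hf : Measurable f)
    (h2 : IntegrableOn (fun x => f x ^ 2) I01) (h : l2norm f ≤ 1) :
    Integrable f mu01 ∧ ∫ y in I01, |f y| ≤ 1 := by
  have hi : Integrable f mu01 :=
    ((memLp_two_iff_integrable_sq hf.aestronglyMeasurable).2 h2).integrable (by norm_num)
  refine ⟨hi, ?_⟩
  have h3 := sq_le_of_l2 h
  have : ∫ y in I01, |f y| ≤ ∫ y in I01, (1 + f y ^ 2) / 2 := by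
    refine integral_mono hi.abs (((integrable_const _).add h2).div_const 2) fun y => ?_
    have := sq_nonneg (|f y| - 1)
    have := sq_abs (f y)
    simp only
    nlinarith
  rw [integral_div, integral_add (integrable_const _) h2] at this
  simp at this
  linarith

theorem cut_bdd {D : ℝ → ℝ → ℝ} {K : ℝ}
    (hK : ∀ x y, |D x y| ≤ K) :
    BddAbove {r | ∃ A B : Set ℝ, MeasurableSet A ∧ MeasurableSet B ∧ A ⊆ I01 ∧ B ⊆ I01 ∧
    r = |∫ x in A, ∫ y in B, D x y|} := by
  have hK0 : 0 ≤ K := (abs_nonneg _).trans (hK 0 0)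
  have hvol : ∀ A ⊆ I01, volume A < ⊤ ∧ volume.real A ≤ 1 := by
    intro A hA
    have h1 : volume A ≤ 1 := (measure_mono hA).trans (by simp [I01])
    refine ⟨h1.trans_lt (by simp), ?_⟩
    exact ENNReal.toReal_le_of_le_ofReal zero_le_one (by simpa using h1)
  refine ⟨K, ?_⟩
  rintro r ⟨A, B, hA, hB, hA1, hB1, rfl⟩
  have hin : ∀ x, ‖∫ y in B, D x y‖ ≤ K := fun x =>
    (norm_setIntegral_le_of_norm_le_const (hvol B hB1).1 (fun y _ => hK x y)).trans
      (mul_le_of_le_one_right hK0 (hvol B hB1).2)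
  exact (norm_setIntegral_le_of_norm_le_const (hvol A hA1).1 (fun x _ => hin x)).trans
      (mul_le_of_le_one_right hK0 (hvol A hA1).2)

theorem le_cut {D : ℝ → ℝ → ℝ} {K : ℝ}
    (hK : ∀ x y, |D x y| ≤ K) {A B : Set ℝ} (hA : MeasurableSet A) (hB : MeasurableSet B)
    (hA1 : A ⊆ I01) (hB1 : B ⊆ I01) : |∫ x in A, ∫ y in B, D x y| ≤ cutNorm D :=
  le_csSup (cut_bdd hK) ⟨A, B, hA, hB, hA1, hB1, rfl⟩

/-- Splitting of the `L¹` norm by sign. -/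
theorem l1_split {h : ℝ → ℝ} (hm : Measurable h) (hi : Integrable h mu01) :
    ∃ A B : Set ℝ, MeasurableSet A ∧ MeasurableSet B ∧ A ⊆ I01 ∧ B ⊆ I01 ∧
      ∫ x in I01, |h x| ≤ |∫ x in A, h x| + |∫ x in B, h x| := by
  have hP : MeasurableSet {x | 0 ≤ h x} := measurableSet_le measurable_const hm
  refine ⟨{x | 0 ≤ h x} ∩ I01, {x | 0 ≤ h x}ᶜ ∩ I01, hP.inter meas_I01,
    hP.compl.inter meas_I01, Set.inter_subset_right, Set.inter_subset_right, ?_⟩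
  rw [← integral_add_compl hP hi.abs]
  rw [Measure.restrict_restrict hP, Measure.restrict_restrict hP.compl]
  refine add_le_add ?_ ?_
  · refine le_trans (le_of_eq ?_) (le_abs_self _)
    refine setIntegral_congr_fun (hP.inter meas_I01) fun x hx => ?_
    exact abs_of_nonneg hx.1
  · refine le_trans (le_of_eq ?_) (neg_le_abs _)
    rw [← integral_neg]
    refine setIntegral_congr_fun (hP.compl.inter meas_I01) fun x hx => ?_
    exact abs_of_neg (not_le.1 hx.1)

theorem prod_int {D : ℝ → ℝ → ℝ} (hD : Measurable (Function.uncurry D)) {K : ℝ}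
    (hK : ∀ x y, |D x y| ≤ K) (ν₁ ν₂ : Measure ℝ) [IsFiniteMeasure ν₁] [IsFiniteMeasure ν₂] :
    Integrable (Function.uncurry D) (ν₁.prod ν₂) :=
  Integrable.of_bound hD.aestronglyMeasurable K (ae_of_all _ fun p => hK p.1 p.2)

theorem fin_of_sub {A : Set ℝ} (hA : A ⊆ I01) : IsFiniteMeasure (volume.restrict A) :=
  ⟨by
    rw [Measure.restrict_apply_univ]
    exact (measure_mono hA).trans_lt (by simp [I01])⟩

theorem l1_applyT {D : ℝ → ℝ → ℝ} (hD : Measurable (Function.uncurry D)) {K : ℝ}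
    (hK : ∀ x y, |D x y| ≤ K) {f : ℝ → ℝ} (hf : Measurable f) {L : ℝ}
    (hL : ∀ x, |f x| ≤ L) :
    ∫ x in I01, |applyT D f x| ≤ 4 * L * cutNorm D := by
  have hL0 : 0 ≤ L := (abs_nonneg _).trans (hL 0)
  have hfi : Integrable f mu01 := int_of_bound hf hL _
  have key : ∀ A : Set ℝ, MeasurableSet A → A ⊆ I01 →
      |∫ x in A, applyT D f x| ≤ L * (2 * cutNorm D) := by
    intro A hA hA1
    haveI := fin_of_sub hA1
    have hDf : Measurable (Function.uncurry fun x y => D x y * f y) :=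
      hD.mul (hf.comp measurable_snd)
    have hDfK : ∀ x y, |D x y * f y| ≤ K * L := fun x y => by
      rw [abs_mul]
      exact mul_le_mul (hK x y) (hL y) (abs_nonneg _) ((abs_nonneg _).trans (hK x y))
    have hDs : Measurable (Function.uncurry fun y x => D x y) := hD.comp measurable_swap
    have hh := setInt_meas hDs (volume.restrict A)
    have hhi : Integrable (fun y => ∫ x in A, D x y) mu01 :=
      (prod_int hDs (fun y x => hK x y) mu01 (volume.restrict A)).integral_prod_left
    have e : ∫ x in A, applyT D f x = ∫ y in I01, (∫ x in A, D x y) * f y := by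
      unfold applyT
      rw [integral_integral_swap (prod_int hDf hDfK _ _)]
      simp only [integral_mul_const]
    obtain ⟨B, C, hB, hC, hB1, hC1, hBC⟩ := l1_split hh hhi
    have sw : ∀ B, MeasurableSet B → B ⊆ I01 →
        |∫ y in B, ∫ x in A, D x y| ≤ cutNorm D := by
      intro B hB hB1
      haveI := fin_of_sub hB1
      rw [← integral_integral_swap (prod_int hD hK _ _)]
      exact le_cut hK hA hB hA1 hB1
    rw [e]
    calc |∫ y in I01, (∫ x in A, D x y) * f y|
        ≤ ∫ y in I01, L * |∫ x in A, D x y| := by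
          rw [← Real.norm_eq_abs]
          refine norm_integral_le_of_norm_le (hhi.abs.const_mul L) (ae_of_all _ fun y => ?_)
          rw [Real.norm_eq_abs, abs_mul, mul_comm]
          exact mul_le_mul_of_nonneg_right (hL y) (abs_nonneg _)
      _ = L * ∫ y in I01, |∫ x in A, D x y| := integral_const_mul _ _
      _ ≤ L * (2 * cutNorm D) := by
          refine mul_le_mul_of_nonneg_left ?_ hL0
          linarith [sw B hB hB1, sw C hC hC1]
  have hm := applyT_meas hD hf
  obtain ⟨A, B, hA, hB, hA1, hB1, hAB⟩ :=
    l1_split hm (int_of_bound hm (applyT_bound hK hfi) _)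
  linarith [key A hA hA1, key B hB hB1]

theorem applyT_add {D : ℝ → ℝ → ℝ} (hD : Measurable (Function.uncurry D)) {K : ℝ}
    (hK : ∀ x y, |D x y| ≤ K) {f g : ℝ → ℝ} (hf : Integrable f mu01)
    (hg : Integrable g mu01) (x : ℝ) :
    applyT D (fun y => f y + g y) x = applyT D f x + applyT D g x := by
  unfold applyT
  rw [← integral_add (row_int hD hK hf x) (row_int hD hK hg x)]
  simp only [mul_add]

/-- The main quantitative bound. -/
theorem l2_applyT {D : ℝ → ℝ → ℝ} (hD : Measurable (Function.uncurry D)) {K : ℝ}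
    (hK : ∀ x y, |D x y| ≤ K) {f : ℝ → ℝ} (hf : Measurable f)
    (h2 : IntegrableOn (fun x => f x ^ 2) I01) (h : l2norm f ≤ 1) {L : ℝ} (hL : 0 < L) :
    ∫ x in I01, applyT D f x ^ 2 ≤ 8 * K * L * cutNorm D + 2 * (K / L) ^ 2 := by
  have hK0 : 0 ≤ K := (abs_nonneg _).trans (hK 0 0)
  obtain ⟨hfi, hf1⟩ := l1_le hf h2 h
  have hS : MeasurableSet {x | |f x| ≤ L} := measurableSet_le hf.abs measurable_const
  set f1 := Set.indicator {x | |f x| ≤ L} f with hf1def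
  set f2 := Set.indicator {x | |f x| ≤ L}ᶜ f with hf2def
  have m1 : Measurable f1 := hf.indicator hS
  have m2 : Measurable f2 := hf.indicator hS.compl
  have i1 : Integrable f1 mu01 := hfi.indicator hS
  have i2 : Integrable f2 mu01 := hfi.indicator hS.compl
  have hsum : f = fun y => f1 y + f2 y := by
    funext y
    exact (congrFun (Set.indicator_self_add_compl {x | |f x| ≤ L} f) y).symm
  have b1 : ∀ x, |f1 x| ≤ L := by
    intro x
    by_cases hx : |f x| ≤ L
    · simp [hf1def, Set.indicator, hx]
    · simp [hf1def, Set.indicator, hx, hL.le]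
  have n1 : ∫ y in I01, |f1 y| ≤ 1 := by
    refine (integral_mono i1.abs hfi.abs fun y => ?_).trans hf1
    by_cases hx : |f y| ≤ L <;> simp [hf1def, Set.indicator, hx]
  have n2 : ∫ y in I01, |f2 y| ≤ 1 / L := by
    have : ∫ y in I01, |f2 y| ≤ ∫ y in I01, f y ^ 2 / L := by
      refine integral_mono i2.abs (h2.div_const L) fun y => ?_
      by_cases hx : |f y| ≤ L
      · simp only [hf2def, Set.indicator, Set.mem_compl_iff, Set.mem_ofPred_eq, hx]
        simp
        positivity
      · simp only [hf2def, Set.indicator, Set.mem_compl_iff, Set.mem_ofPred_eq, hx]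
        simp
        rw [le_div_iff₀ hL, ← sq_abs (f y)]
        push Not at hx
        nlinarith [abs_nonneg (f y)]
    rw [integral_div] at this
    exact this.trans (div_le_div_of_nonneg_right (sq_le_of_l2 h) hL.le)
  have t1 : ∀ x, |applyT D f1 x| ≤ K := fun x =>
    (applyT_bound hK i1 x).trans (mul_le_of_le_one_right hK0 n1)
  have t2 : ∀ x, |applyT D f2 x| ≤ K / L := fun x => by
    refine (applyT_bound hK i2 x).trans ?_
    rw [div_eq_mul_one_div]
    exact mul_le_mul_of_nonneg_left n2 hK0
  have T1 := applyT_meas hD m1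
  have pt : ∀ x, applyT D f x ^ 2 ≤ 2 * K * |applyT D f1 x| + 2 * (K / L) ^ 2 := by
    intro x
    rw [hsum, applyT_add hD hK i1 i2]
    have a1 : applyT D f1 x ^ 2 ≤ K * |applyT D f1 x| := by
      rw [← sq_abs, sq]
      exact mul_le_mul_of_nonneg_right (t1 x) (abs_nonneg _)
    have a2 : applyT D f2 x ^ 2 ≤ (K / L) ^ 2 := by
      rw [← sq_abs]
      exact pow_le_pow_left₀ (abs_nonneg _) (t2 x) 2
    nlinarith [sq_nonneg (applyT D f1 x - applyT D f2 x)]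
  have iT1 : Integrable (fun x => 2 * K * |applyT D f1 x|) mu01 :=
    (int_of_bound T1 t1 _).abs.const_mul _
  have hl := l1_applyT hD hK m1 b1
  calc ∫ x in I01, applyT D f x ^ 2
      ≤ ∫ x in I01, (2 * K * |applyT D f1 x| + 2 * (K / L) ^ 2) := by
        refine integral_mono_of_nonneg (ae_of_all _ fun x => sq_nonneg _)
          (iT1.add (integrable_const _)) (ae_of_all _ pt)
    _ = 2 * K * (∫ x in I01, |applyT D f1 x|) + 2 * (K / L) ^ 2 := by
        rw [integral_add iT1 (integrable_const _), integral_const_mul, integral_const]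
        simp
    _ ≤ 8 * K * L * cutNorm D + 2 * (K / L) ^ 2 := by
        have := mul_le_mul_of_nonneg_left hl (by positivity : 0 ≤ 2 * K)
        nlinarith

theorem l2norm_eq {h : ℝ → ℝ} (hm : Measurable h) : l2norm h = lpNorm h 2 mu01 := by
  rw [lpNorm_eq_integral_norm_rpow_toReal (by norm_num) (by norm_num) hm.aestronglyMeasurable]
  simp [l2norm, Real.sqrt_eq_rpow]

theorem l2norm_add_le {g h : ℝ → ℝ} (hg : Measurable g) (hh : Measurable h) {C : ℝ}
    (bg : ∀ x, |g x| ≤ C) :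
    l2norm (fun x => g x + h x) ≤ l2norm g + l2norm h := by
  rw [l2norm_eq hg, l2norm_eq hh, l2norm_eq (h := fun x => g x + h x) (hg.add hh)]
  exact lpNorm_add_le (MemLp.of_bound hg.aestronglyMeasurable C (ae_of_all _ bg)) (by norm_num)

theorem opNorm_bdd {U : ℝ → ℝ → ℝ} {K : ℝ} (hK : ∀ x y, |U x y| ≤ K) :
    BddAbove {r | ∃ f : ℝ → ℝ, Measurable f ∧
    MeasureTheory.IntegrableOn (fun x => f x ^ 2) I01 ∧
    l2norm f ≤ 1 ∧ r = l2norm (applyT U f)} := by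
  have hK0 : 0 ≤ K := (abs_nonneg _).trans (hK 0 0)
  refine ⟨K, ?_⟩
  rintro r ⟨f, hf, h2, h, rfl⟩
  obtain ⟨hfi, hf1⟩ := l1_le hf h2 h
  have b : ∀ x, |applyT U f x| ≤ K := fun x =>
    (applyT_bound hK hfi x).trans (mul_le_of_le_one_right hK0 hf1)
  unfold l2norm
  rw [Real.sqrt_le_left hK0]
  calc ∫ x in I01, applyT U f x ^ 2 ≤ ∫ x in I01, K ^ 2 := by
        refine integral_mono_of_nonneg (ae_of_all _ fun x => sq_nonneg _)
          (integrable_const _) (ae_of_all _ fun x => ?_)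
        simp only
        rw [← sq_abs]
        exact pow_le_pow_left₀ (abs_nonneg _) (b x) 2
    _ = K ^ 2 := by simp

theorem opNorm_nonempty (U : ℝ → ℝ → ℝ) : {r | ∃ f : ℝ → ℝ, Measurable f ∧
    MeasureTheory.IntegrableOn (fun x => f x ^ 2) I01 ∧
    l2norm f ≤ 1 ∧ r = l2norm (applyT U f)}.Nonempty :=
  ⟨_, fun _ => 0, measurable_const, by simp, by simp [l2norm], rfl⟩

/-- Operator norms of close kernels are close (one-sided). -/
theorem opNorm_le_add {U V D : ℝ → ℝ → ℝ} (hU : Measurable (Function.uncurry U))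
    (hV : Measurable (Function.uncurry V))
    {K : ℝ} (hVK : ∀ x y, |V x y| ≤ K)
    (hDK : ∀ x y, |D x y| ≤ K) (hD : Measurable (Function.uncurry D))
    (hUV : ∀ x y, U x y = V x y + D x y) {L : ℝ} (hL : 0 < L) :
    opNorm U ≤ opNorm V + Real.sqrt (8 * K * L * cutNorm D + 2 * (K / L) ^ 2) := by
  refine csSup_le (opNorm_nonempty U) ?_
  rintro r ⟨f, hf, h2, h, rfl⟩
  obtain ⟨hfi, hf1⟩ := l1_le hf h2 h
  have e : applyT U f = fun x => applyT V f x + applyT D f x := by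
    funext x
    unfold applyT
    rw [← integral_add (row_int hV hVK hfi x) (row_int hD hDK hfi x)]
    simp only [hUV, add_mul]
  rw [e]
  refine (l2norm_add_le (applyT_meas hV hf) (applyT_meas hD hf)
    (applyT_bound hVK hfi)).trans ?_
  exact add_le_add (le_csSup (opNorm_bdd hVK) ⟨f, hf, h2, h, rfl⟩)
    (Real.sqrt_le_sqrt (l2_applyT hD hDK hf h2 h hL))

theorem int_comp {φ : ℝ → ℝ} (hφ : MeasurePreserving φ mu01 mu01) {g : ℝ → ℝ}
    (hg : Measurable g) : ∫ x in I01, g (φ x) = ∫ x in I01, g x := by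
  have := integral_map hφ.measurable.aemeasurable (μ := mu01) (f := g) hg.aestronglyMeasurable
  rw [← this, hφ.map_eq]

theorem applyT_comp {φ : ℝ → ℝ} (hφ : MeasurePreserving φ mu01 mu01) {V : ℝ → ℝ → ℝ}
    (hV : Measurable (Function.uncurry V)) {g : ℝ → ℝ} (hg : Measurable g) (x : ℝ) :
    applyT (fun x y => V (φ x) (φ y)) (fun y => g (φ y)) x = applyT V g (φ x) :=
  int_comp hφ (g := fun y => V (φ x) y * g y) ((row_meas hV (φ x)).mul hg)

theorem l2norm_comp {φ : ℝ → ℝ} (hφ : MeasurePreserving φ mu01 mu01) {g : ℝ → ℝ}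
    (hg : Measurable g) : l2norm (fun x => g (φ x)) = l2norm g := by
  unfold l2norm
  rw [int_comp hφ (g := fun x => g x ^ 2) (hg.pow_const 2)]

theorem opNorm_comp {φ : ℝ → ℝ} (hφ : MeasurePreserving φ mu01 mu01) (hb : Set.BijOn φ I01 I01)
    {V : ℝ → ℝ → ℝ} (hV : Measurable (Function.uncurry V)) :
    opNorm (fun x y => V (φ x) (φ y)) = opNorm V := by
  unfold opNorm
  congr 1
  ext r
  have sqc : ∀ g : ℝ → ℝ, Measurable g → (IntegrableOn (fun x => g (φ x) ^ 2) I01 ↔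
      IntegrableOn (fun x => g x ^ 2) I01) := by
    intro g hg
    exact hφ.integrable_comp (g := fun x => g x ^ 2) (hg.pow_const 2).aestronglyMeasurable
  constructor
  · rintro ⟨f, hf, h2, h, rfl⟩
    have hemb : MeasurableEmbedding (fun x : I01 => φ x) := by
      haveI : StandardBorelSpace I01 := meas_I01.standardBorel
      refine Measurable.measurableEmbedding (hφ.measurable.comp measurable_subtype_coe) ?_
      intro x y hxy
      exact Subtype.ext (hb.injOn x.2 y.2 hxy)
    obtain ⟨g, hg, hgf⟩ := hemb.exists_measurable_extend
      (hf.comp (measurable_subtype_coe (p := fun x => x ∈ I01))) fun x => ⟨x⟩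
    have hgf' : ∀ x ∈ I01, g (φ x) = f x := fun x hx => congrFun hgf ⟨x, hx⟩
    have h2' : IntegrableOn (fun x => g (φ x) ^ 2) I01 :=
      h2.congr_fun (fun x hx => by simp only [hgf' x hx]) meas_I01
    have e1 : l2norm f = l2norm g := by
      rw [← l2norm_comp hφ hg]
      unfold l2norm
      congr 1
      exact setIntegral_congr_fun meas_I01 fun x hx => by simp only [hgf' x hx]
    have e2 : applyT (fun x y => V (φ x) (φ y)) f = fun x => applyT V g (φ x) := by
      funext x
      rw [← applyT_comp hφ hV hg]
      unfold applyT
      exact setIntegral_congr_fun meas_I01 fun y hy => by simp only [hgf' y hy]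
    refine ⟨g, hg, (sqc g hg).1 h2', e1 ▸ h, ?_⟩
    rw [e2, l2norm_comp hφ (applyT_meas hV hg)]
  · rintro ⟨g, hg, h2, h, rfl⟩
    refine ⟨fun x => g (φ x), hg.comp hφ.measurable, (sqc g hg).2 h2, ?_, ?_⟩
    · rw [l2norm_comp hφ hg]
      exact h
    · rw [← l2norm_comp hφ (applyT_meas hV hg)]
      congr 1
      funext x
      exact (applyT_comp hφ hV hg x).symm

theorem cutNorm_neg (D : ℝ → ℝ → ℝ) : cutNorm (fun x y => - D x y) = cutNorm D := by
  unfold cutNorm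
  simp only [integral_neg, abs_neg]

/-- Uniform continuity of the operator norm in the cut distance. -/
theorem opNorm_close {U V : ℝ → ℝ → ℝ} (hU : IsGraphon U) (hV : IsGraphon V) {K : ℝ}
    (hUK : ∀ x y, U x y ≤ K) (hVK : ∀ x y, V x y ≤ K) {δ L : ℝ} (hL : 0 < L)
    (hδ : cutDist U V < δ) :
    |opNorm U - opNorm V| ≤ Real.sqrt (8 * K * L * δ + 2 * (K / L) ^ 2) := by
  obtain ⟨hUm, hU0, -, -⟩ := hU
  obtain ⟨hVm, hV0, -, -⟩ := hV
  have hK0 : 0 ≤ K := (hU0 0 0).trans (hUK 0 0)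
  unfold cutDist at hδ
  obtain ⟨r, ⟨φ, hφ, hb, rfl⟩, hr⟩ := exists_lt_of_csInf_lt (by
    exact ⟨_, id, MeasurePreserving.id _, Set.bijOn_id _, rfl⟩) hδ
  rw [← opNorm_comp hφ hb hVm]
  set V' : ℝ → ℝ → ℝ := fun x y => V (φ x) (φ y) with hV'
  have hV'm : Measurable (Function.uncurry V') :=
    hVm.comp ((hφ.measurable.comp measurable_fst).prodMk (hφ.measurable.comp measurable_snd))
  have hDm : Measurable (Function.uncurry fun x y => U x y - V' x y) := hUm.sub hV'm
  have hDm' : Measurable (Function.uncurry fun x y => - (U x y - V' x y)) := hDm.neg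
  have aU : ∀ x y, |U x y| ≤ K := fun x y => abs_le.2 ⟨by linarith [hU0 x y], hUK x y⟩
  have aV : ∀ x y, |V' x y| ≤ K := fun x y =>
    abs_le.2 ⟨by linarith [hV0 (φ x) (φ y)], hVK _ _⟩
  have aD : ∀ x y, |U x y - V' x y| ≤ K := fun x y => by
    have h1 := hU0 x y
    have h2 := hUK x y
    have h3 : 0 ≤ V' x y := hV0 _ _
    have h4 : V' x y ≤ K := hVK _ _
    exact abs_le.2 ⟨by linarith, by linarith⟩
  have l1 := opNorm_le_add hUm hV'm aV aD hDm (fun x y => by ring) hL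
  have l2 := opNorm_le_add hV'm hUm aU (fun x y => by rw [abs_neg]; exact aD x y) hDm'
    (fun x y => by ring) hL
  rw [cutNorm_neg] at l2
  have mono : Real.sqrt (8 * K * L * cutNorm (fun x y => U x y - V' x y) + 2 * (K / L) ^ 2)
      ≤ Real.sqrt (8 * K * L * δ + 2 * (K / L) ^ 2) := by
    refine Real.sqrt_le_sqrt ?_
    have : 8 * K * L * cutNorm (fun x y => U x y - V' x y) ≤ 8 * K * L * δ :=
      mul_le_mul_of_nonneg_left hr.le (by positivity)
    linarith
  exact abs_le.2 ⟨by linarith, by linarith⟩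

end Percolation

open Percolation MeasureTheory Filter Topology in
/-- If `(W_n)` is a uniformly bounded sequence of graphons and `W` a
graphon with `δ_□(W_n, W) → 0`, then `‖T_{W_n}‖ → ‖T_W‖`. -/
theorem opNorm_tendsto_of_cutDist_tendsto_zero
    (Wseq : ℕ → ℝ → ℝ → ℝ) (hWseq : ∀ n, IsGraphon (Wseq n))
    (M : ℝ) (hM : ∀ n x y, Wseq n x y ≤ M)
    (W : ℝ → ℝ → ℝ) (hW : IsGraphon W)
    (hconv : Tendsto (fun n => cutDist (Wseq n) W) atTop (nhds 0)) :
    Tendsto (fun n => opNorm (Wseq n)) atTop (nhds (opNorm W)) := by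
  obtain ⟨MW, hMW⟩ := hW.2.2.2
  set K := max M MW with hK
  have hK0 : 0 ≤ K := ((hW.2.1 0 0).trans (hMW 0 0)).trans (le_max_right _ _)
  rw [Metric.tendsto_atTop]
  intro ε hε
  set L := 2 * (K + 1) / ε with hLdef
  have hL : 0 < L := by positivity
  have hKL : K / L ≤ ε / 2 := by
    rw [hLdef, div_le_iff₀ (by positivity)]
    have : ε / 2 * (2 * (K + 1) / ε) = K + 1 := by field_simp
    linarith
  have hKL2 : 2 * (K / L) ^ 2 ≤ ε ^ 2 / 2 := by
    have := pow_le_pow_left₀ (by positivity) hKL 2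
    nlinarith
  set δ := ε ^ 2 / (4 * (8 * K * L + 1)) with hδdef
  have hδ : 0 < δ := by positivity
  have hδ2 : 8 * K * L * δ ≤ ε ^ 2 / 4 := by
    have : (8 * K * L + 1) * δ = ε ^ 2 / 4 := by
      rw [hδdef]
      field_simp
    nlinarith
  obtain ⟨N, hN⟩ := eventually_atTop.1 (hconv.eventually (gt_mem_nhds hδ))
  refine ⟨N, fun n hn => ?_⟩
  rw [Real.dist_eq]
  refine (opNorm_close (hWseq n) hW (fun x y => (hM n x y).trans (le_max_left M MW))
    (fun x y => (hMW x y).trans (le_max_right M MW)) hL (hN n hn)).trans_lt ?_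
  rw [Real.sqrt_lt' hε]
  have : 0 < ε ^ 2 := by positivity
  linarith
end
end
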